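/- The set Col(V) ∩ R^n has empty interior in R^n if and only if ρ(T) = 0. -/

import Mathlib

open scoped Classical BigOperators

noncomputable section

namespace TropReg

/-- `x` is a vector of `Rmax = ℝ ∪ {-∞}`, modeled inside `EReal` as having no `+∞` entry. -/
def IsRmax {n : ℕ} (x : Fin n → EReal) : Prop := ∀ i, x i ≠ ⊤

/-- Embedding of a real vector into `(Rmax)^n`. -/
def ofReal {n : ℕ} (a : Fin n → ℝ) : Fin n → EReal := fun i => (a i : EReal)

/-- Hilbert's projective metric on `(Rmax)^n`, with values in `[0,+∞] ⊆ EReal`;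
`d(⊥,⊥) = 0` by convention, and the infimum of the empty set is `+∞`. -/
def hd {n : ℕ} (x y : Fin n → EReal) : EReal :=
  if x = ⊥ ∧ y = ⊥ then 0
  else sInf { t : EReal | ∃ lam mu : ℝ, t = (lam : EReal) - (mu : EReal) ∧
        (∀ i, (mu : EReal) + y i ≤ x i) ∧ (∀ i, x i ≤ (lam : EReal) + y i) }

/-- Closed Hilbert ball of center `a` and radius `r`, inside `(Rmax)^n`. -/
def ball {n : ℕ} (a : Fin n → EReal) (r : EReal) : Set (Fin n → EReal) :=
  { x | IsRmax x ∧ hd a x ≤ r }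

/-- Hilbert distance from a point to a set. -/
def distPt {n : ℕ} (x : Fin n → EReal) (B : Set (Fin n → EReal)) : EReal :=
  ⨅ b ∈ B, hd x b

/-- One-sided Hausdorff distance from `A` to `B` for Hilbert's metric. -/
def distHS {n : ℕ} (A B : Set (Fin n → EReal)) : EReal :=
  ⨆ a ∈ A, distPt a B

/-- Tropical hyperplane associated with `a`: the maximum `max_i (a_i + x_i)` is
attained at least twice. -/
def hyper {n : ℕ} (a : Fin n → EReal) : Set (Fin n → EReal) :=
  { x | IsRmax x ∧ ∃ i j : Fin n, i ≠ j ∧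
      a i + x i = (⨆ k, a k + x k) ∧ a j + x j = (⨆ k, a k + x k) }

/-- Tropical column space of the matrix `V`. -/
def colSpace {n p : ℕ} (V : Fin n → Fin p → EReal) : Set (Fin n → EReal) :=
  { y | ∃ x : Fin p → EReal, IsRmax x ∧ y = fun i => ⨆ k, (V i k + x k) }

/-- The `k`-th column of `V`. -/
def col {n p : ℕ} (V : Fin n → Fin p → EReal) (k : Fin p) : Fin n → EReal :=
  fun i => V i k

/-- The set of columns of `V`. -/
def cols {n p : ℕ} (V : Fin n → Fin p → EReal) : Set (Fin n → EReal) :=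
  Set.range (col V)

/-- The Shapley operator associated with the matrix `V`. -/
def TV {n p : ℕ} (V : Fin n → Fin p → EReal) (x : Fin n → EReal) : Fin n → EReal :=
  fun i => ⨅ k ∈ { k : Fin p | V i k ≠ ⊥ },
    (-(V i k) + ⨆ j ∈ { j : Fin n | j ≠ i }, (V j k + x j))

/-- Tropical spectral radius of an operator `T`. -/
def rho {n : ℕ} (T : (Fin n → EReal) → (Fin n → EReal)) : EReal :=
  sSup { lam : EReal | lam ≠ ⊤ ∧ ∃ u : Fin n → EReal, IsRmax u ∧ u ≠ ⊥ ∧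
      T u = fun i => lam + u i }

/-- Tropical convex cone in `(Rmax)^n`. -/
def IsTropCone {n : ℕ} (C : Set (Fin n → EReal)) : Prop :=
  (∀ x ∈ C, ∀ y ∈ C, (fun i => x i ⊔ y i) ∈ C) ∧
  (∀ x ∈ C, ∀ lam : EReal, lam ≠ ⊤ → (fun i => lam + x i) ∈ C)

/-- Tropical span: smallest tropical cone containing `Vs`. -/
def span {n : ℕ} (Vs : Set (Fin n → EReal)) : Set (Fin n → EReal) :=
  ⋂₀ { C | IsTropCone C ∧ Vs ⊆ C }

/-- Inner radius: supremum of radii of Hilbert balls centered at finite points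
included in `W`. -/
def inradius {n : ℕ} (W : Set (Fin n → EReal)) : EReal :=
  sSup { r : EReal | ∃ s : ℝ, r = (s : EReal) ∧ 0 ≤ s ∧
      ∃ a : Fin n → ℝ, ball (ofReal a) r ⊆ W }

lemma add_le_add_iff_of_real (c : ℝ) (x y : EReal) :
    (c : EReal) + x ≤ (c : EReal) + y ↔ x ≤ y := by
  refine ⟨fun h => ?_, fun h => by gcongr⟩
  have h' : ((-c : ℝ) : EReal) + (c + x) ≤ ((-c : ℝ) : EReal) + (c + y) := by gcongr
  rwa [← add_assoc, ← add_assoc, ← EReal.coe_add, neg_add_cancel, EReal.coe_zero, zero_add,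
    zero_add] at h'

lemma exists_real {x : EReal} (hb : x ≠ ⊥) (ht : x ≠ ⊤) : ∃ c : ℝ, x = c :=
  ⟨x.toReal, (EReal.coe_toReal ht hb).symm⟩

lemma TV_le_iff {n p : ℕ} {V : Fin n → Fin p → EReal} (hVtop : ∀ i k, V i k ≠ ⊤)
    (hrow : ∀ i, ∃ k, V i k ≠ ⊥) (x : Fin n → EReal) (i : Fin n) (c : EReal) :
    TV V x i ≤ c ↔ ∃ k, V i k ≠ ⊥ ∧ ∀ j, j ≠ i → V j k + x j ≤ V i k + c := by
  have key : ∀ k, V i k ≠ ⊥ →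
      ((-(V i k) + ⨆ j ∈ { j : Fin n | j ≠ i }, (V j k + x j)) ≤ c ↔
        ∀ j, j ≠ i → V j k + x j ≤ V i k + c) := by
    intro k hk
    obtain ⟨r, hr⟩ := exists_real hk (hVtop i k)
    rw [hr, ← add_le_add_iff_of_real r, ← add_assoc, ← EReal.coe_neg, ← EReal.coe_add]
    simp
  constructor
  · intro h
    obtain ⟨k₀, hk₀⟩ := hrow i
    obtain ⟨k, hk, hmin⟩ := Set.exists_min_image { k : Fin p | V i k ≠ ⊥ }
      (fun k => -(V i k) + ⨆ j ∈ { j : Fin n | j ≠ i }, (V j k + x j))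
      (Set.toFinite _) ⟨k₀, hk₀⟩
    refine ⟨k, hk, (key k hk).1 (le_trans ?_ h)⟩
    exact le_iInf₂ fun l hl => hmin l hl
  · rintro ⟨k, hk, h⟩
    exact (iInf₂_le k hk).trans ((key k hk).2 h)

lemma TV_le_add {n p : ℕ} {V : Fin n → Fin p → EReal} (hVtop : ∀ i k, V i k ≠ ⊤)
    (hrow : ∀ i, ∃ k, V i k ≠ ⊥) {x y : Fin n → EReal} {c : ℝ}
    (h : ∀ j, x j ≤ (c : EReal) + y j) (i : Fin n) : TV V x i ≤ (c : EReal) + TV V y i := by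
  obtain ⟨k, hk, hy⟩ := (TV_le_iff hVtop hrow y i _).1 le_rfl
  refine (TV_le_iff hVtop hrow x i _).2 ⟨k, hk, fun j hj => ?_⟩
  calc V j k + x j ≤ V j k + (c + y j) := by gcongr; exact h j
    _ = c + (V j k + y j) := by rw [add_left_comm]
    _ ≤ c + (V i k + TV V y i) := add_le_add le_rfl (hy j hj)
    _ = V i k + (c + TV V y i) := by rw [add_left_comm]

lemma TV_mono {n p : ℕ} (V : Fin n → Fin p → EReal) : Monotone (TV V) := by
  intro x y h i
  unfold TV
  gcongr with k hk j hj
  exact h j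

lemma continuous_const_add {c : EReal} (hc : c ≠ ⊤) : Continuous fun x : EReal => c + x := by
  induction c with
  | bot => simpa using continuous_const
  | top => exact absurd rfl hc
  | coe r =>
    refine continuous_iff_continuousAt.2 fun x => ?_
    exact (EReal.continuousAt_add (p := ((r : EReal), x)) (by simp) (by simp)).comp
      (continuous_const.prodMk continuous_id).continuousAt

lemma continuous_TV {n p : ℕ} {V : Fin n → Fin p → EReal} (hVtop : ∀ i k, V i k ≠ ⊤) :
    Continuous (TV V) := by
  refine continuous_pi fun i => ?_
  have e : (fun x => TV V x i) = fun x : Fin n → EReal =>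
      (Finset.univ.filter fun k : Fin p => V i k ≠ ⊥).inf fun k =>
        -(V i k) + (Finset.univ.filter fun j : Fin n => j ≠ i).sup fun j => V j k + x j := by
    funext x
    simp [TV, Finset.inf_eq_iInf, Finset.sup_eq_iSup]
  rw [e]
  refine Continuous.finset_inf_apply fun k hk => ?_
  have hk' : V i k ≠ ⊥ := by simpa using hk
  refine (continuous_const_add (by simpa using hk')).comp ?_
  exact Continuous.finset_sup_apply fun j _ =>
    (continuous_const_add (hVtop j k)).comp (continuous_apply j)

/-- Real points of the column space are the opposites of real super-fixed points of `TV V`. -/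
lemma ofReal_mem_colSpace_iff {n p : ℕ} {V : Fin n → Fin p → EReal}
    (hVtop : ∀ i k, V i k ≠ ⊤) (hrow : ∀ i, ∃ k, V i k ≠ ⊥) (hcol : ∀ k, ∃ i, V i k ≠ ⊥)
    (a : Fin n → ℝ) :
    ofReal a ∈ colSpace V ↔ ∀ i, TV V (ofReal (-a)) i ≤ ofReal (-a) i := by
  constructor
  · rintro ⟨x, hx, hax⟩ i
    have hle : ∀ j k, V j k + x k ≤ a j := fun j k => by
      have := congrFun hax j
      simp only [ofReal] at this
      rw [this]
      exact le_iSup (fun k => V j k + x k) k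
    obtain ⟨k₀, -⟩ := hrow i
    have : Nonempty (Fin p) := ⟨k₀⟩
    obtain ⟨k, hk⟩ := exists_eq_ciSup_of_finite (f := fun k => V i k + x k)
    have hki : V i k + x k = a i := hk.trans (congrFun hax i).symm
    have hVk : V i k ≠ ⊥ := by
      intro h
      simp [h] at hki
    have hxk : x k ≠ ⊥ := by
      intro h
      simp [h] at hki
    obtain ⟨r, hr⟩ := exists_real hVk (hVtop i k)
    obtain ⟨s, hs⟩ := exists_real hxk (hx k)
    refine (TV_le_iff hVtop hrow _ i _).2 ⟨k, hVk, fun j _ => ?_⟩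
    have hj := hle j k
    rw [hr, hs] at hki
    rw [hs] at hj
    simp only [ofReal, Pi.neg_apply]
    rw [hr]
    induction hv : V j k with
    | bot => simp
    | top => exact absurd hv (hVtop j k)
    | coe q =>
      rw [hv] at hj
      norm_cast at hj hki ⊢
      linarith
  · intro h
    refine ⟨fun k => ⨅ i, ((a i : EReal) - V i k), fun k => ?_, ?_⟩
    · obtain ⟨i, hi⟩ := hcol k
      obtain ⟨r, hr⟩ := exists_real hi (hVtop i k)
      refine ne_top_of_le_ne_top ?_ (iInf_le _ i)
      rw [hr, ← EReal.coe_sub]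
      exact EReal.coe_ne_top _
    · funext i
      refine le_antisymm ?_ (iSup_le fun k => ?_)
      · obtain ⟨k, hk, hj⟩ := (TV_le_iff hVtop hrow _ i _).1 (h i)
        obtain ⟨r, hr⟩ := exists_real hk (hVtop i k)
        refine le_trans ?_ (le_iSup _ k)
        have : ((a i - r : ℝ) : EReal) ≤ ⨅ l, ((a l : EReal) - V l k) := by
          refine le_iInf fun l => ?_
          by_cases hl : l = i
          · subst hl
            rw [hr, EReal.coe_sub]
          · have := hj l hl
            simp only [ofReal, Pi.neg_apply] at this
            rw [hr] at this
            induction hv : V l k with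
            | bot => simp
            | top => exact absurd hv (hVtop l k)
            | coe q =>
              rw [hv] at this
              norm_cast at this ⊢
              linarith
        calc ofReal a i = (r : EReal) + ((a i - r : ℝ) : EReal) := by
              rw [← EReal.coe_add]; simp [ofReal]
          _ ≤ _ := by rw [hr]; gcongr
      · induction hv : V i k with
        | bot => simp
        | top => exact absurd hv (hVtop i k)
        | coe q =>
          calc (q : EReal) + ⨅ l, ((a l : EReal) - V l k)
              ≤ (q : EReal) + ((a i : EReal) - V i k) := by gcongr; exact iInf_le _ i
            _ = ofReal a i := by
              rw [hv, ← EReal.coe_sub, ← EReal.coe_add]; simp [ofReal]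

lemma exists_TV_le_self {n p : ℕ} {V : Fin n → Fin p → EReal}
    (hVtop : ∀ i k, V i k ≠ ⊤) (hrow : ∀ i, ∃ k, V i k ≠ ⊥) (hcol : ∀ k, ∃ i, V i k ≠ ⊥) :
    ∃ v : Fin n → ℝ, ∀ i, TV V (ofReal v) i ≤ ofReal v i := by
  have h : ∀ i, ∃ r : ℝ, (r : EReal) = ⨆ k, V i k := fun i => by
    obtain ⟨k₀, hk₀⟩ := hrow i
    have : Nonempty (Fin p) := ⟨k₀⟩
    obtain ⟨k, hk⟩ := exists_eq_ciSup_of_finite (f := fun k => V i k)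
    have hb : V i k ≠ ⊥ := by
      intro hb
      rw [hb] at hk
      exact hk₀ (le_bot_iff.1 (hk ▸ le_iSup (fun k => V i k) k₀))
    obtain ⟨r, hr⟩ := exists_real hb (hVtop i k)
    exact ⟨r, hr ▸ hk⟩
  choose a ha using h
  refine ⟨-a, (ofReal_mem_colSpace_iff hVtop hrow hcol a).1 ⟨fun _ => 0, fun _ => by simp, ?_⟩⟩
  funext i
  simp [ofReal, ha]

/-- Collatz–Wielandt upper bound for the tropical spectral radius. -/
lemma rho_le_of_TV_le {n p : ℕ} {V : Fin n → Fin p → EReal}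
    (hVtop : ∀ i k, V i k ≠ ⊤) (hrow : ∀ i, ∃ k, V i k ≠ ⊥) {u : Fin n → ℝ} {c : ℝ}
    (hu : ∀ i, TV V (ofReal u) i ≤ (c : EReal) + ofReal u i) : rho (TV V) ≤ c := by
  refine sSup_le ?_
  rintro m ⟨-, w, hw, hw0, hTw⟩
  obtain ⟨j₀, hj₀⟩ : ∃ j, w j ≠ ⊥ := by
    by_contra! h
    exact hw0 (funext h)
  have : Nonempty (Fin n) := ⟨j₀⟩
  obtain ⟨i, hi⟩ := Finite.exists_max fun j => ((-u j : ℝ) : EReal) + w j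
  have hwi : w i ≠ ⊥ := by
    intro h
    have h0 := hi j₀
    obtain ⟨r, hr⟩ := exists_real hj₀ (hw j₀)
    rw [h, hr, ← EReal.coe_add, EReal.add_bot, le_bot_iff] at h0
    exact EReal.coe_ne_bot _ h0
  obtain ⟨s, hs⟩ := exists_real hwi (hw i)
  have hle : ∀ j, w j ≤ ((s - u i : ℝ) : EReal) + ofReal u j := fun j => by
    have h0 := hi j
    rw [hs] at h0
    simp only [ofReal]
    induction hv : w j with
    | bot => simp
    | top => exact absurd hv (hw j)
    | coe q =>
      rw [hv] at h0
      norm_cast at h0 ⊢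
      linarith
  have h1 := (TV_le_add hVtop hrow hle i).trans
    (add_le_add (le_refl ((s - u i : ℝ) : EReal)) (hu i))
  simp only [hTw] at h1
  rw [hs] at h1
  have h2 : ((s - u i : ℝ) : EReal) + ((c : EReal) + ofReal u i) = (s : EReal) + c := by
    simp only [ofReal]
    norm_cast
    ring
  rw [h2, add_comm] at h1
  exact (add_le_add_iff_of_real s _ _).1 h1

/-- The map `T ⊔ (-1 + ·)`, on real vectors. -/
def dampedStep {n : ℕ} (T : (Fin n → EReal) → (Fin n → EReal)) (a : Fin n → ℝ) : Fin n → ℝ :=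
  fun i => (T (ofReal a) i ⊔ ((-1 + a i : ℝ) : EReal)).toReal

lemma coe_dampedStep {n : ℕ} {T : (Fin n → EReal) → (Fin n → EReal)} {a : Fin n → ℝ}
    (h : T (ofReal a) ≤ ofReal a) (i : Fin n) :
    (dampedStep T a i : EReal) = T (ofReal a) i ⊔ ((-1 + a i : ℝ) : EReal) := by
  refine EReal.coe_toReal ?_ ?_
  · refine ne_top_of_le_ne_top (EReal.coe_ne_top (a i)) (sup_le (h i) ?_)
    exact EReal.coe_le_coe_iff.2 (by linarith)
  · exact ne_bot_of_le_ne_bot (EReal.coe_ne_bot _) le_sup_right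

lemma dampedStep_le {n : ℕ} {T : (Fin n → EReal) → (Fin n → EReal)} {a : Fin n → ℝ}
    (h : T (ofReal a) ≤ ofReal a) : dampedStep T a ≤ a := by
  intro i
  rw [← EReal.coe_le_coe_iff, coe_dampedStep h]
  exact sup_le (h i) (EReal.coe_le_coe_iff.2 (by linarith))

lemma apply_le_dampedStep {n : ℕ} {T : (Fin n → EReal) → (Fin n → EReal)} {a : Fin n → ℝ}
    (h : T (ofReal a) ≤ ofReal a) : T (ofReal a) ≤ ofReal (dampedStep T a) := by
  intro i
  rw [ofReal, coe_dampedStep h]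
  exact le_sup_left

lemma ofReal_mono {n : ℕ} : Monotone (ofReal (n := n)) :=
  fun _ _ h i => EReal.coe_le_coe_iff.2 (h i)

lemma iterate_dampedStep_superFixed {n : ℕ} {T : (Fin n → EReal) → (Fin n → EReal)}
    (hT : Monotone T) {a : Fin n → ℝ} (h : T (ofReal a) ≤ ofReal a) (m : ℕ) :
    T (ofReal ((dampedStep T)^[m] a)) ≤ ofReal ((dampedStep T)^[m] a) := by
  induction m with
  | zero => exact h
  | succ m ih =>
    rw [Function.iterate_succ_apply']
    exact (hT (ofReal_mono (dampedStep_le ih))).trans (apply_le_dampedStep ih)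

/-- Averaging an orbit along which every coordinate drops by at least `1` gives a vector on which
`TV V` decreases every coordinate uniformly. -/
lemma exists_TV_le_of_orbit {n p : ℕ} {V : Fin n → Fin p → EReal}
    (hVtop : ∀ i k, V i k ≠ ⊤) (hrow : ∀ i, ∃ k, V i k ≠ ⊥) {v : ℕ → Fin n → ℝ}
    (hv : ∀ m, TV V (ofReal (v m)) ≤ ofReal (v (m + 1))) {K : ℕ}
    (hK : ∀ i, v (K + 1) i ≤ v 0 i - 1) :
    ∃ u : Fin n → ℝ, ∃ c < (0 : ℝ), ∀ i, TV V (ofReal u) i ≤ (c : EReal) + ofReal u i := by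
  set N : ℝ := K + 1 with hN
  have hNpos : 0 < N := by positivity
  let u : Fin n → ℝ := fun i =>
    (Finset.range (K + 1)).inf' Finset.nonempty_range_add_one fun j => v j i + j / N
  have hstep : ∀ j ∈ Finset.range (K + 1), ∀ i,
      TV V (ofReal u) i ≤ ((j / N + v (j + 1) i : ℝ) : EReal) := by
    intro j hj i
    rw [EReal.coe_add]
    refine (TV_le_add hVtop hrow (c := j / N) (y := ofReal (v j)) (fun l => ?_) i).trans ?_
    · simp only [ofReal]
      norm_cast
      rw [add_comm]
      exact Finset.inf'_le _ hj
    · gcongr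
      exact hv j i
  refine ⟨u, -(1 / N), by simpa using hNpos, fun i => ?_⟩
  obtain ⟨j, hj, hju⟩ := Finset.exists_mem_eq_inf' Finset.nonempty_range_add_one
    fun j : ℕ => v j i + j / N
  have hui : u i = v j i + j / N := hju
  simp only [ofReal]
  rw [hui, ← EReal.coe_add]
  cases j with
  | zero =>
    refine (hstep K (by simp) i).trans (EReal.coe_le_coe_iff.2 ?_)
    have h1 : (K : ℝ) / N = 1 - 1 / N := by
      rw [hN]; field_simp; ring
    have := hK i
    rw [h1]
    simp
    linarith
  | succ j =>
    have hj' : j ∈ Finset.range (K + 1) := by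
      simp only [Finset.mem_range] at hj ⊢
      omega
    refine (hstep j hj' i).trans (EReal.coe_le_coe_iff.2 ?_)
    push_cast
    rw [add_div]
    linarith

/-- Either `TV V` decreases all coordinates of some real vector uniformly, or it has a nontrivial
fixed point in `(Rmax)^n`. -/
lemma exists_TV_le_or_exists_fixed {n p : ℕ} {V : Fin n → Fin p → EReal}
    (hVtop : ∀ i k, V i k ≠ ⊤) (hrow : ∀ i, ∃ k, V i k ≠ ⊥) {a : Fin n → ℝ}
    (ha : TV V (ofReal a) ≤ ofReal a) :
    (∃ u : Fin n → ℝ, ∃ c < (0 : ℝ), ∀ i, TV V (ofReal u) i ≤ (c : EReal) + ofReal u i) ∨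
      ∃ w : Fin n → EReal, IsRmax w ∧ w ≠ ⊥ ∧ TV V w = w := by
  set v : ℕ → Fin n → ℝ := fun m => (dampedStep (TV V))^[m] a with hv
  have hsuper : ∀ m, TV V (ofReal (v m)) ≤ ofReal (v m) :=
    iterate_dampedStep_superFixed (TV_mono V) ha
  have hsucc : ∀ m, v (m + 1) = dampedStep (TV V) (v m) := fun m =>
    Function.iterate_succ_apply' _ _ _
  have hTv : ∀ m, TV V (ofReal (v m)) ≤ ofReal (v (m + 1)) := fun m => by
    rw [hsucc]
    exact apply_le_dampedStep (hsuper m)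
  have hanti : Antitone v := antitone_nat_of_succ_le fun m => by
    rw [hsucc]
    exact dampedStep_le (hsuper m)
  set w : Fin n → EReal := fun i => ⨅ m, (v m i : EReal) with hw
  by_cases hbot : w = ⊥
  · left
    have hex : ∀ i, ∃ m, v m i < v 0 i - 1 := fun i => by
      have h0 : (⨅ m, (v m i : EReal)) < ((v 0 i - 1 : ℝ) : EReal) := by
        have : (⨅ m, (v m i : EReal)) = ⊥ := congrFun hbot i
        rw [this]
        exact EReal.bot_lt_coe _
      obtain ⟨m, hm⟩ := iInf_lt_iff.1 h0
      exact ⟨m, EReal.coe_lt_coe_iff.1 hm⟩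
    choose f hf using hex
    refine exists_TV_le_of_orbit hVtop hrow hTv (K := Finset.univ.sup f) fun i => ?_
    refine le_trans (hanti ?_ i) (hf i).le
    exact (Finset.le_sup (Finset.mem_univ i)).trans (Nat.le_succ _)
  · right
    refine ⟨w, fun i => ne_top_of_le_ne_top (EReal.coe_ne_top (v 0 i)) (iInf_le _ 0), hbot, ?_⟩
    have hle : TV V w ≤ w := fun i => by
      refine le_iInf fun m => ?_
      exact (TV_mono V (fun j => iInf_le _ m) i).trans (hsuper m i)
    refine le_antisymm hle fun i => ?_
    have hlim : Filter.Tendsto (fun m => ofReal (v m)) Filter.atTop (nhds w) :=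
      tendsto_pi_nhds.2 fun j => tendsto_atTop_iInf fun _ _ h =>
        EReal.coe_le_coe_iff.2 (hanti h j)
    have hT := tendsto_pi_nhds.1 (((continuous_TV hVtop).tendsto w).comp hlim) i
    have hi := tendsto_pi_nhds.1 hlim i
    have hd := ((continuous_const_add (EReal.coe_ne_top (-1))).tendsto (w i)).comp hi
    have heq : w i = TV V w i ⊔ (((-1 : ℝ) : EReal) + w i) := by
      refine tendsto_nhds_unique (hi.comp (Filter.tendsto_add_atTop_nat 1))
        ((hT.sup_nhds hd).congr fun m => ?_)
      simp only [Function.comp_apply, ofReal]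
      rw [hsucc, coe_dampedStep (hsuper m), EReal.coe_add]
    by_cases hwi : w i = ⊥
    · rw [hwi]
      exact bot_le
    · obtain ⟨s, hs⟩ := exists_real hwi
        (ne_top_of_le_ne_top (EReal.coe_ne_top (v 0 i)) (iInf_le _ 0))
      have hlt : ((-1 : ℝ) : EReal) + w i < w i := by
        rw [hs, ← EReal.coe_add]
        exact EReal.coe_lt_coe_iff.2 (by linarith)
      rcases le_sup_iff.1 heq.le with h | h
      · exact h
      · exact absurd h (not_le.2 hlt)

lemma interior_nonempty_iff {n p : ℕ} {V : Fin n → Fin p → EReal}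
    (hVtop : ∀ i k, V i k ≠ ⊤) (hrow : ∀ i, ∃ k, V i k ≠ ⊥) (hcol : ∀ k, ∃ i, V i k ≠ ⊥) :
    (interior { a : Fin n → ℝ | ofReal a ∈ colSpace V }).Nonempty ↔
      ∃ u : Fin n → ℝ, ∃ c < (0 : ℝ), ∀ i, TV V (ofReal u) i ≤ (c : EReal) + ofReal u i := by
  constructor
  · rintro ⟨a, ha⟩
    obtain ⟨ε, hε, hball⟩ := Metric.mem_nhds_iff.1 (mem_interior_iff_mem_nhds.1 ha)
    refine ⟨-a, -(ε / 2), by linarith, fun i => ?_⟩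
    set b : Fin n → ℝ := Function.update a i (a i + ε / 2) with hb
    have hmem : b ∈ Metric.ball a ε := by
      rw [Metric.mem_ball, dist_pi_lt_iff hε]
      intro j
      by_cases hj : j = i
      · subst hj
        simp only [hb, Function.update_self, Real.dist_eq, add_sub_cancel_left]
        rw [abs_of_pos (by linarith)]
        linarith
      · simpa [hb, hj] using hε
    have h := (ofReal_mem_colSpace_iff hVtop hrow hcol b).1 (hball hmem) i
    obtain ⟨k, hk, hj⟩ := (TV_le_iff hVtop hrow _ i _).1 h
    have hbi : ofReal (-b) i = ((-(ε / 2) : ℝ) : EReal) + ofReal (-a) i := by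
      simp only [ofReal, hb, Pi.neg_apply, Function.update_self]
      norm_cast
      ring
    refine (TV_le_iff hVtop hrow _ i _).2 ⟨k, hk, fun j hji => ?_⟩
    have hbj : ofReal (-b) j = ofReal (-a) j := by simp [ofReal, hb, hji]
    rw [← hbi, ← hbj]
    exact hj j hji
  · rintro ⟨u, c, hc, hu⟩
    refine ⟨-u, mem_interior_iff_mem_nhds.2 (Metric.mem_nhds_iff.2 ⟨-c / 2, by linarith, ?_⟩)⟩
    intro b hb
    rw [Metric.mem_ball, dist_pi_lt_iff (by linarith)] at hb
    refine (ofReal_mem_colSpace_iff hVtop hrow hcol b).2 fun i => ?_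
    have habs : ∀ j, |b j + u j| < -c / 2 := fun j => by
      simpa [Real.dist_eq] using hb j
    refine (TV_le_add hVtop hrow (c := -c / 2) (y := ofReal u) (fun j => ?_) i).trans
      ((add_le_add (le_refl ((-c / 2 : ℝ) : EReal)) (hu i)).trans ?_)
    · simp only [ofReal, Pi.neg_apply]
      norm_cast
      linarith [(abs_lt.1 (habs j)).1]
    · simp only [ofReal, Pi.neg_apply]
      norm_cast
      linarith [(abs_lt.1 (habs i)).2]

/-- The set `Col(V) ∩ ℝ^n` has empty interior in `ℝ^n` if and only if
`ρ(T) = 0`, where `T = T_V`. -/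
theorem stmt4 {n p : ℕ} (V : Fin n → Fin p → EReal)
    (hVtop : ∀ i k, V i k ≠ ⊤)
    (hrow : ∀ i, ∃ k, V i k ≠ ⊥) (hcol : ∀ k, ∃ i, V i k ≠ ⊥) :
    interior { a : Fin n → ℝ | ofReal a ∈ colSpace V } = ∅ ↔ rho (TV V) = 0 := by
  rw [← Set.not_nonempty_iff_eq_empty, interior_nonempty_iff hVtop hrow hcol]
  constructor
  · intro h
    obtain ⟨a, ha⟩ := exists_TV_le_self hVtop hrow hcol
    refine le_antisymm (rho_le_of_TV_le (c := 0) hVtop hrow (u := a) (by simpa using ha))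
      (le_sSup ⟨EReal.zero_ne_top, ?_⟩)
    obtain ⟨w, hw, hw0, hTw⟩ := (exists_TV_le_or_exists_fixed hVtop hrow ha).resolve_left h
    exact ⟨w, hw, hw0, by simpa using hTw⟩
  · rintro h ⟨u, c, hc, hu⟩
    have := rho_le_of_TV_le hVtop hrow hu
    rw [h] at this
    exact absurd (EReal.coe_nonneg.1 this) (not_le.2 hc)

end TropReg
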